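/- Let 𝔤 be a finite-dimensional real Lie algebra with inner product ⟨·,·⟩ and let X ∈ 𝔤, X ≠ 0, satisfy the Berwald conditions. Let F be the Kropina metric F(u) = ⟨u,u⟩/⟨X,u⟩ and g_y its fundamental tensor. Let y, v ∈ 𝔤 be orthonormal with ⟨X,y⟩ > 0, and set R_y(v) = ∇_v∇_y y − ∇_y∇_v y − ∇_{[v,y]}y with ∇ the Levi-Civita product. Then the flag curvature satisfies g_y(R_y(v),v) / (g_y(y,y)g_y(v,v) − g_y(y,v)²) = (1 / (F(y)⁴⟨X,v⟩² + F(y)²)) · ⟨R_y(v),v⟩. -/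

import Mathlib

/-- The Kropina metric `F(u) = ⟨u,u⟩ / ⟨X,u⟩` associated with an inner product (given as
a bilinear form `g`) and a vector `X`. -/
noncomputable def kropinaMetric {𝔤 : Type*} [AddCommGroup 𝔤] [Module ℝ 𝔤]
    (g : 𝔤 →ₗ[ℝ] 𝔤 →ₗ[ℝ] ℝ) (X : 𝔤) (u : 𝔤) : ℝ :=
  g u u / g X u

/-- The fundamental tensor of a Finsler norm `F` at `y`:
`g_y(u,w) = (1/2) ∂²/∂s∂t [F(y + s u + t w)²]` at `s = t = 0`. -/
noncomputable def fundamentalTensor {𝔤 : Type*} [AddCommGroup 𝔤] [Module ℝ 𝔤]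
    (F : 𝔤 → ℝ) (y u w : 𝔤) : ℝ :=
  (1 / 2) * deriv (fun s : ℝ => deriv (fun t : ℝ => (F (y + s • u + t • w)) ^ 2) 0) 0

section KropinaMetric

variable {𝔤 : Type*} [AddCommGroup 𝔤] [Module ℝ 𝔤] (g : 𝔤 →ₗ[ℝ] 𝔤 →ₗ[ℝ] ℝ)

theorem hasDerivAt_bilin_self_line (hsymm : ∀ x y : 𝔤, g x y = g y x) (p w : 𝔤) :
    HasDerivAt (fun t : ℝ => g (p + t • w) (p + t • w)) (2 * g p w) 0 := by
  have h : (fun t : ℝ => g (p + t • w) (p + t • w)) =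
      fun t : ℝ => g p p + 2 * g p w * t + g w w * t ^ 2 := by
    funext t
    simp only [map_add, map_smul, LinearMap.add_apply, LinearMap.smul_apply, smul_eq_mul,
      hsymm w p]
    ring
  rw [h]
  simpa using (((hasDerivAt_id' (0 : ℝ)).const_mul (2 * g p w)).const_add (g p p)).fun_add
    (((hasDerivAt_id' (0 : ℝ)).fun_pow 2).const_mul (g w w))

theorem hasDerivAt_linear_line (f : 𝔤 →ₗ[ℝ] ℝ) (p w : 𝔤) :
    HasDerivAt (fun t : ℝ => f (p + t • w)) (f w) 0 := by
  have h : (fun t : ℝ => f (p + t • w)) = fun t : ℝ => f p + t * f w := by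
    funext t
    simp
  rw [h]
  simpa using ((hasDerivAt_id (0 : ℝ)).mul_const (f w)).const_add (f p)

/-- Directional derivative of the square of a Kropina metric. -/
theorem hasDerivAt_kropinaMetric_sq (hsymm : ∀ x y : 𝔤, g x y = g y x) (X p w : 𝔤)
    (hp : g X p ≠ 0) :
    HasDerivAt (fun t : ℝ => kropinaMetric g X (p + t • w) ^ 2)
      (4 * g p p * g p w / g X p ^ 2 - 2 * g p p ^ 2 * g X w / g X p ^ 3) 0 := by
  unfold kropinaMetric
  refine (((hasDerivAt_bilin_self_line g hsymm p w).fun_div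
    (hasDerivAt_linear_line (g X) p w) (by simpa using hp)).fun_pow 2).congr_deriv ?_
  simp only [zero_smul, add_zero, Nat.add_one_sub_one, pow_one]
  field_simp
  ring

/-- The fundamental tensor of a Kropina metric, computed where the metric is defined. -/
theorem fundamentalTensor_kropinaMetric (hsymm : ∀ x y : 𝔤, g x y = g y x) (X y u w : 𝔤)
    (hXy : g X y ≠ 0) :
    fundamentalTensor (kropinaMetric g X) y u w =
      (4 * g y u * g y w + 2 * g y y * g u w) / g X y ^ 2 -
        4 * g y y * (g y u * g X w + g y w * g X u) / g X y ^ 3 +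
        3 * g y y ^ 2 * g X u * g X w / g X y ^ 4 := by
  have hA := hasDerivAt_bilin_self_line g hsymm y u
  have hB := hasDerivAt_linear_line (g X) y u
  have hC : HasDerivAt (fun s : ℝ => g (y + s • u) w) (g u w) 0 :=
    hasDerivAt_linear_line (g.flip w) y u
  have hne : ∀ᶠ s : ℝ in nhds 0, g X (y + s • u) ≠ 0 :=
    hB.continuousAt.eventually_ne (by simpa using hXy)
  have heq : (fun s : ℝ => deriv
      (fun t : ℝ => kropinaMetric g X (y + s • u + t • w) ^ 2) 0) =ᶠ[nhds 0]
      fun s : ℝ => 4 * g (y + s • u) (y + s • u) * g (y + s • u) w / g X (y + s • u) ^ 2 -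
        2 * g (y + s • u) (y + s • u) ^ 2 * g X w / g X (y + s • u) ^ 3 := by
    filter_upwards [hne] with s hs
    exact (hasDerivAt_kropinaMetric_sq g hsymm X _ w hs).deriv
  have hD := (((hA.const_mul 4).fun_mul hC).fun_div (hB.fun_pow 2)
    (by simpa using hXy)).fun_sub
      ((((hA.fun_pow 2).const_mul 2).mul_const (g X w)).fun_div (hB.fun_pow 3)
        (by simpa using hXy))
  rw [fundamentalTensor, heq.deriv_eq, hD.deriv]
  simp only [zero_smul, add_zero]
  field_simp
  ring

end KropinaMetric

section LeviCivita

variable {𝔤 : Type*} [LieRing 𝔤] [LieAlgebra ℝ 𝔤] {g : 𝔤 →ₗ[ℝ] 𝔤 →ₗ[ℝ] ℝ}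
  {nabla : 𝔤 →ₗ[ℝ] 𝔤 →ₗ[ℝ] 𝔤}

/-- The Levi-Civita product is metric. -/
theorem leviCivita_skew
    (hLC : ∀ x y z : 𝔤, 2 * g (nabla x y) z = g ⁅x, y⁆ z - g ⁅y, z⁆ x + g ⁅z, x⁆ y)
    (x a b : 𝔤) : g (nabla x a) b = -g (nabla x b) a := by
  have h₁ := hLC x a b
  have h₂ := hLC x b a
  rw [← lie_skew x b, ← lie_skew b a, ← lie_skew a x] at h₂
  simp only [map_neg, LinearMap.neg_apply] at h₂
  linarith

/-- Under the Berwald conditions on `X`, the image of the Levi-Civita product is orthogonal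
to `X`. -/
theorem leviCivita_orthogonal_of_berwald
    (hLC : ∀ x y z : 𝔤, 2 * g (nabla x y) z = g ⁅x, y⁆ z - g ⁅y, z⁆ x + g ⁅z, x⁆ y)
    {X : 𝔤} (hB1 : ∀ y z : 𝔤, g ⁅y, X⁆ z + g ⁅z, X⁆ y = 0)
    (hB2 : ∀ y z : 𝔤, g ⁅y, z⁆ X = 0) (x a : 𝔤) : g (nabla x a) X = 0 := by
  have h₁ := hLC x a X
  have h₂ := hB1 a x
  rw [hB2, ← lie_skew X x, map_neg, LinearMap.neg_apply] at h₁
  linarith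

end LeviCivita

/-- Flag curvature of a left invariant Kropina metric of Berwald type:
for a metric Lie algebra `(𝔤, g)`, `X ≠ 0` satisfying the Berwald conditions,
the Levi-Civita product `∇` (`nabla`), orthonormal `y, v` with `⟨X, y⟩ > 0`, and
`R_y(v) = ∇_v ∇_y y − ∇_y ∇_v y − ∇_{[v,y]} y`, one has
`g_y(R_y(v),v) / (g_y(y,y) g_y(v,v) − g_y(y,v)²)
  = (1 / (F(y)⁴ ⟨X,v⟩² + F(y)²)) ⟨R_y(v), v⟩`. -/
theorem kropina_berwald_flag_curvature
    {𝔤 : Type*} [LieRing 𝔤] [LieAlgebra ℝ 𝔤] [Module.Finite ℝ 𝔤]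
    (g : 𝔤 →ₗ[ℝ] 𝔤 →ₗ[ℝ] ℝ)
    (hsymm : ∀ x y : 𝔤, g x y = g y x)
    (hpos : ∀ x : 𝔤, x ≠ 0 → 0 < g x x)
    (X : 𝔤) (hX : X ≠ 0)
    (hB1 : ∀ y z : 𝔤, g ⁅y, X⁆ z + g ⁅z, X⁆ y = 0)
    (hB2 : ∀ y z : 𝔤, g ⁅y, z⁆ X = 0)
    (nabla : 𝔤 →ₗ[ℝ] 𝔤 →ₗ[ℝ] 𝔤)
    (hLC : ∀ x y z : 𝔤, 2 * g (nabla x y) z = g ⁅x, y⁆ z - g ⁅y, z⁆ x + g ⁅z, x⁆ y)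
    (y v : 𝔤) (hy : g y y = 1) (hv : g v v = 1) (hyv : g y v = 0)
    (hXy : 0 < g X y)
    (R : 𝔤) (hR : R = nabla v (nabla y y) - nabla y (nabla v y) - nabla ⁅v, y⁆ y) :
    fundamentalTensor (kropinaMetric g X) y R v /
        (fundamentalTensor (kropinaMetric g X) y y y *
            fundamentalTensor (kropinaMetric g X) y v v -
          (fundamentalTensor (kropinaMetric g X) y y v) ^ 2) =
      (1 / ((kropinaMetric g X y) ^ 4 * (g X v) ^ 2 + (kropinaMetric g X y) ^ 2)) *
        g R v := by
  have hRX : g X R = 0 := by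
    have h := leviCivita_orthogonal_of_berwald hLC hB1 hB2
    rw [hsymm, hR]
    simp [h]
  have hRy : g y R = 0 := by
    have h₁ := leviCivita_skew hLC v (nabla y y) y
    have h₂ := leviCivita_skew hLC y (nabla v y) y
    have h₃ := leviCivita_skew hLC ⁅v, y⁆ y y
    have h₄ := hsymm (nabla v y) (nabla y y)
    rw [hsymm, hR]
    simp only [map_sub, LinearMap.sub_apply]
    linarith
  have hT := fun u w => fundamentalTensor_kropinaMetric g hsymm X y u w hXy.ne'
  have hF : kropinaMetric g X y = 1 / g X y := by rw [kropinaMetric, hy]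
  rw [hT, hT, hT, hT, hF, hRX, hRy, hy, hv, hyv]
  generalize g X y = b at hXy ⊢
  generalize g X v = c
  have hbc : b ^ 2 + c ^ 2 ≠ 0 := by positivity
  have hdet : ((4 * 1 * 1 + 2 * 1 * 1) / b ^ 2 - 4 * 1 * (1 * b + 1 * b) / b ^ 3 +
      3 * 1 ^ 2 * b * b / b ^ 4) * ((4 * 0 * 0 + 2 * 1 * 1) / b ^ 2 -
      4 * 1 * (0 * c + 0 * c) / b ^ 3 + 3 * 1 ^ 2 * c * c / b ^ 4) -
      ((4 * 1 * 0 + 2 * 1 * 0) / b ^ 2 - 4 * 1 * (1 * c + 0 * b) / b ^ 3 +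
      3 * 1 ^ 2 * b * c / b ^ 4) ^ 2 = 2 * (b ^ 2 + c ^ 2) / b ^ 6 := by
    field_simp
    ring
  have hsum : (1 / b) ^ 4 * c ^ 2 + (1 / b) ^ 2 = (b ^ 2 + c ^ 2) / b ^ 4 := by
    field_simp
    ring
  rw [hdet, hsum]
  field_simp
  ring
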